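/- On ℂ³ ⊗ ℂ³ with standard basis |0⟩,|1⟩,|2⟩ of ℂ³, define the eight unit product vectors ψ₂ = |0⟩⊗(|0⟩+|1⟩)/√2, ψ₃ = |0⟩⊗(|0⟩−|1⟩)/√2, ψ₄ = |2⟩⊗(|1⟩+|2⟩)/√2, ψ₅ = |2⟩⊗(|1⟩−|2⟩)/√2, ψ₆ = ((|1⟩+|2⟩)/√2)⊗|0⟩, ψ₇ = ((|1⟩−|2⟩)/√2)⊗|0⟩, ψ₈ = ((|0⟩+|1⟩)/√2)⊗|2⟩, ψ₉ = ((|0⟩−|1⟩)/√2)⊗|2⟩, and let ρ₀ = (1/8) Σ_{i=2}^{9} |ψ_i⟩⟨ψ_i|. Let |Ψ₊⟩ = (|0⟩⊗|1⟩ + |1⟩⊗|0⟩)/√2. Then ρ₀ is separable, and for every ε with 0 < ε < 1 the state (1−ε)ρ₀ + ε|Ψ₊⟩⟨Ψ₊| is entangled; hence ρ₀ is a separable state with entangled states arbitrarily close to it. -/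

import Mathlib

open Matrix Kronecker BigOperators
open scoped ComplexOrder

noncomputable section

/-- A quantum state: positive semidefinite, trace one. -/
def IsState {n : Type*} [Fintype n] [DecidableEq n] (ρ : Matrix n n ℂ) : Prop :=
  ρ.PosSemidef ∧ ρ.trace = 1

/-- Separability on a bipartite system `ℂ^dA ⊗ ℂ^dB`. -/
def SeparableState {dA dB : ℕ} (ρ : Matrix (Fin dA × Fin dB) (Fin dA × Fin dB) ℂ) : Prop :=
  ∃ (m : ℕ) (p : Fin m → ℝ) (A : Fin m → Matrix (Fin dA) (Fin dA) ℂ)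
    (B : Fin m → Matrix (Fin dB) (Fin dB) ℂ),
    (∀ k, 0 ≤ p k) ∧ (∑ k, p k) = 1 ∧ (∀ k, IsState (A k)) ∧ (∀ k, IsState (B k)) ∧
    ρ = ∑ k, ((p k : ℂ) • (A k ⊗ₖ B k))

/-- An entangled state is a state that is not separable. -/
def EntangledState {dA dB : ℕ} (ρ : Matrix (Fin dA × Fin dB) (Fin dA × Fin dB) ℂ) : Prop :=
  IsState ρ ∧ ¬ SeparableState ρ

/-- Trace distance: half the sum of absolute values of the eigenvalues of `ρ - τ`. -/
def traceDist {n : Type*} [Fintype n] [DecidableEq n] (ρ τ : Matrix n n ℂ) : ℝ :=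
  if h : (ρ - τ).IsHermitian then (1/2) * ∑ i, |h.eigenvalues i| else 0

/-- Standard basis vector of `ℂ^d`. -/
def bv {d : ℕ} (a : ℕ) (h : a < d) : Fin d → ℂ := Pi.single ⟨a, h⟩ (1 : ℂ)

/-- Standard basis of `ℂ²`. -/
def ket2 (a : Fin 2) : Fin 2 → ℂ := Pi.single a 1

/-- Standard basis of `ℂ³`. -/
def ket3 (a : Fin 3) : Fin 3 → ℂ := Pi.single a 1

/-- `|+⟩ = (|0⟩+|1⟩)/√2`. -/
def ketPlus : Fin 2 → ℂ := (Real.sqrt 2 : ℂ)⁻¹ • (ket2 0 + ket2 1)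

/-- `|−⟩ = (|0⟩−|1⟩)/√2`. -/
def ketMinus : Fin 2 → ℂ := (Real.sqrt 2 : ℂ)⁻¹ • (ket2 0 - ket2 1)

/-- Kronecker product of vectors. -/
def vecKron {dA dB : ℕ} (v : Fin dA → ℂ) (w : Fin dB → ℂ) : Fin dA × Fin dB → ℂ :=
  fun p => v p.1 * w p.2

/-- `|ψ₊⟩ = (|01⟩+|10⟩)/√2`. -/
def psiPlus : Fin 2 × Fin 2 → ℂ :=
  (Real.sqrt 2 : ℂ)⁻¹ • (vecKron (ket2 0) (ket2 1) + vecKron (ket2 1) (ket2 0))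

/-- `|φ₊⟩ = (|00⟩+|11⟩)/√2`. -/
def phiPlus : Fin 2 × Fin 2 → ℂ :=
  (Real.sqrt 2 : ℂ)⁻¹ • (vecKron (ket2 0) (ket2 0) + vecKron (ket2 1) (ket2 1))

/-- The projector `|v⟩⟨v|`. -/
def proj {n : Type*} (v : n → ℂ) : Matrix n n ℂ := vecMulVec v (star v)

/-- Partial transpose on the first factor. -/
def PT {dA dB : ℕ} (ρ : Matrix (Fin dA × Fin dB) (Fin dA × Fin dB) ℂ) :
    Matrix (Fin dA × Fin dB) (Fin dA × Fin dB) ℂ :=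
  Matrix.of fun p q => ρ (q.1, p.2) (p.1, q.2)

/-- `⟨v|M|w⟩`. -/
def braket {n : Type*} [Fintype n] (v : n → ℂ) (M : Matrix n n ℂ) (w : n → ℂ) : ℂ :=
  star v ⬝ᵥ (M *ᵥ w)

/-- A state is classical with respect to the family of vectors `v` on the `A` side. -/
def ClassicalWrt {dA dB : ℕ} (v : Fin dA → Fin dA → ℂ)
    (ρ : Matrix (Fin dA × Fin dB) (Fin dA × Fin dB) ℂ) : Prop :=
  ∃ (lam : Fin dA → ℝ) (τ : Fin dA → Matrix (Fin dB) (Fin dB) ℂ),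
    (∀ i, 0 ≤ lam i) ∧ (∀ i, IsState (τ i)) ∧
    ρ = ∑ i, ((lam i : ℂ) • (proj (v i) ⊗ₖ τ i))

/-- Orthonormality of a family of `dA` vectors of `ℂ^dA` (hence an orthonormal basis). -/
def IsONBasis {d : ℕ} (v : Fin d → Fin d → ℂ) : Prop :=
  ∀ i j, star (v i) ⬝ᵥ v j = if i = j then 1 else 0

/-- A state is classical with respect to `A` if it is classical w.r.t. some
orthonormal basis of `ℂ^dA`; otherwise it is discordant. -/
def ClassicalA {dA dB : ℕ} (ρ : Matrix (Fin dA × Fin dB) (Fin dA × Fin dB) ℂ) : Prop :=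
  ∃ v : Fin dA → Fin dA → ℂ, IsONBasis v ∧ ClassicalWrt v ρ

/-- Hamming weight of a natural number (number of ones in binary). -/
def hammingWt (n : ℕ) : ℕ := (Nat.digits 2 n).sum

/-- `(|0⟩+|1⟩)/√2` on a qutrit. -/
def q01p : Fin 3 → ℂ := (Real.sqrt 2 : ℂ)⁻¹ • (ket3 0 + ket3 1)
/-- `(|0⟩−|1⟩)/√2` on a qutrit. -/
def q01m : Fin 3 → ℂ := (Real.sqrt 2 : ℂ)⁻¹ • (ket3 0 - ket3 1)
/-- `(|1⟩+|2⟩)/√2` on a qutrit. -/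
def q12p : Fin 3 → ℂ := (Real.sqrt 2 : ℂ)⁻¹ • (ket3 1 + ket3 2)
/-- `(|1⟩−|2⟩)/√2` on a qutrit. -/
def q12m : Fin 3 → ℂ := (Real.sqrt 2 : ℂ)⁻¹ • (ket3 1 - ket3 2)
/-- `|Ψ₊⟩ = (|01⟩+|10⟩)/√2` for two qutrits. -/
def PsiPlus3 : Fin 3 × Fin 3 → ℂ :=
  (Real.sqrt 2 : ℂ)⁻¹ • (vecKron (ket3 0) (ket3 1) + vecKron (ket3 1) (ket3 0))

lemma posSemidef_proj {n : Type*} [Fintype n] (v : n → ℂ) : (proj v).PosSemidef :=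
  posSemidef_vecMulVec_self_star v

lemma trace_proj {n : Type*} [Fintype n] (v : n → ℂ) : (proj v).trace = v ⬝ᵥ star v :=
  trace_vecMulVec v (star v)

lemma proj_vecKron {dA dB : ℕ} (v : Fin dA → ℂ) (w : Fin dB → ℂ) :
    proj (vecKron v w) = proj v ⊗ₖ proj w := by
  ext p q
  simp only [proj, vecKron, vecMulVec_apply, kroneckerMap_apply, Pi.star_apply, star_mul']
  ring

/-- A vanishing diagonal entry of a positive semidefinite matrix forces its row to vanish. -/
lemma Matrix.PosSemidef.apply_eq_zero_of_diag_eq_zero {n : Type*} [Fintype n] [DecidableEq n]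
    {A : Matrix n n ℂ} (hA : A.PosSemidef) {i : n} (hi : A i i = 0) (j : n) : A i j = 0 := by
  have hdet := (hA.submatrix ![i, j]).det_nonneg
  have hsymm : A j i = star (A i j) := (hA.isHermitian.apply j i).symm
  simp only [det_fin_two, submatrix_apply, cons_val_zero, cons_val_one, hi, zero_mul, zero_sub,
    hsymm, Complex.star_def, Complex.mul_conj] at hdet
  rw [← Complex.ofReal_neg, Complex.zero_le_real, neg_nonneg] at hdet
  exact Complex.normSq_eq_zero.1 (le_antisymm hdet (Complex.normSq_nonneg _))

/-- If a separable state gives weight zero to the product basis vector `(i, j)`, all its entries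
at `((k, j), (i, l))` vanish: the corresponding row of the partial transpose is zero. -/
lemma SeparableState.apply_eq_zero {dA dB : ℕ}
    {ρ : Matrix (Fin dA × Fin dB) (Fin dA × Fin dB) ℂ} (hρ : SeparableState ρ)
    {i : Fin dA} {j : Fin dB} (hij : ρ (i, j) (i, j) = 0) (k : Fin dA) (l : Fin dB) :
    ρ (k, j) (i, l) = 0 := by
  obtain ⟨m, p, A, B, hp, -, hA, hB, rfl⟩ := hρ
  simp only [Matrix.sum_apply, Matrix.smul_apply, kroneckerMap_apply, smul_eq_mul] at hij ⊢
  have hterm := (Finset.sum_eq_zero_iff_of_nonneg fun t _ => mul_nonneg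
    (Complex.zero_le_real.2 (hp t))
    (mul_nonneg (hA t).1.diag_nonneg (hB t).1.diag_nonneg)).1 hij
  refine Finset.sum_eq_zero fun t ht => ?_
  rcases mul_eq_zero.1 (hterm t ht) with h | h
  · rw [h, zero_mul]
  rcases mul_eq_zero.1 h with h | h
  · have hki : A t k i = 0 := by
      rw [← (hA t).1.isHermitian.apply, (hA t).1.apply_eq_zero_of_diag_eq_zero h, star_zero]
    rw [hki, zero_mul, mul_zero]
  · rw [(hB t).1.apply_eq_zero_of_diag_eq_zero h, mul_zero, mul_zero]

lemma IsState.kronecker {dA dB : ℕ} {A : Matrix (Fin dA) (Fin dA) ℂ}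
    {B : Matrix (Fin dB) (Fin dB) ℂ} (hA : IsState A) (hB : IsState B) : IsState (A ⊗ₖ B) :=
  ⟨hA.1.kronecker hB.1, by rw [trace_kronecker, hA.2, hB.2, one_mul]⟩

lemma IsState.convex_comb {n : Type*} [Fintype n] [DecidableEq n] {ρ σ : Matrix n n ℂ}
    (hρ : IsState ρ) (hσ : IsState σ) {ε : ℝ} (h0 : 0 ≤ ε) (h1 : ε ≤ 1) :
    IsState ((1 - (ε : ℂ)) • ρ + (ε : ℂ) • σ) := by
  refine ⟨(hρ.1.smul ?_).add (hσ.1.smul (Complex.zero_le_real.2 h0)), ?_⟩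
  · rw [← Complex.ofReal_one, ← Complex.ofReal_sub, Complex.zero_le_real]
    exact sub_nonneg.2 h1
  · simp [hρ.2, hσ.2]

lemma SeparableState.isState {dA dB : ℕ}
    {ρ : Matrix (Fin dA × Fin dB) (Fin dA × Fin dB) ℂ} (hρ : SeparableState ρ) : IsState ρ := by
  obtain ⟨m, p, A, B, hp, hsum, hA, hB, rfl⟩ := hρ
  refine ⟨posSemidef_sum _ fun t _ =>
    ((hA t).kronecker (hB t)).1.smul (Complex.zero_le_real.2 (hp t)), ?_⟩
  simp [trace_sum, fun t => ((hA t).kronecker (hB t)).2, ← Complex.ofReal_sum, hsum]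

/-- The trace norm of a difference of positive semidefinite matrices is at most the sum of
their traces. -/
lemma sum_abs_eigenvalues_sub_le {n : Type*} [Fintype n] [DecidableEq n] {M N : Matrix n n ℂ}
    (hM : M.PosSemidef) (hN : N.PosSemidef) (h : (M - N).IsHermitian) :
    ∑ i, |h.eigenvalues i| ≤ M.trace.re + N.trace.re := by
  let U : Matrix n n ℂ := (h.eigenvectorUnitary : Matrix n n ℂ)
  have hUU : U * Uᴴ = 1 := Unitary.coe_mul_star_self h.eigenvectorUnitary
  have htrace (X : Matrix n n ℂ) : X.trace.re = ∑ i, ((Uᴴ * X * U) i i).re := by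
    rw [← Complex.re_sum]
    change X.trace.re = (Uᴴ * X * U).trace.re
    rw [trace_mul_comm, ← Matrix.mul_assoc, hUU, Matrix.one_mul]
  have hdiag (i : n) :
      h.eigenvalues i = ((Uᴴ * M * U) i i).re - ((Uᴴ * N * U) i i).re := by
    rw [← Complex.sub_re, ← Matrix.sub_apply, ← Matrix.sub_mul, ← Matrix.mul_sub, h.eigenvalues_eq i,
      Matrix.mul_assoc]
    rfl
  rw [htrace M, htrace N, ← Finset.sum_add_distrib]
  refine Finset.sum_le_sum fun i _ => ?_
  have hMi := (Complex.le_def.1 ((hM.conjTranspose_mul_mul_same U).diag_nonneg (i := i))).1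
  have hNi := (Complex.le_def.1 ((hN.conjTranspose_mul_mul_same U).diag_nonneg (i := i))).1
  rw [Complex.zero_re] at hMi hNi
  rw [hdiag, abs_le]
  constructor <;> linarith

lemma traceDist_convex_comb_le {n : Type*} [Fintype n] [DecidableEq n] {ρ σ : Matrix n n ℂ}
    (hρ : IsState ρ) (hσ : IsState σ) {ε : ℝ} (h0 : 0 ≤ ε) :
    traceDist ρ ((1 - (ε : ℂ)) • ρ + (ε : ℂ) • σ) ≤ ε := by
  have hε := Complex.zero_le_real.2 h0
  have hsub : ρ - ((1 - (ε : ℂ)) • ρ + (ε : ℂ) • σ) = (ε : ℂ) • ρ - (ε : ℂ) • σ := by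
    rw [sub_smul, one_smul]
    abel
  rw [traceDist, hsub]
  split_ifs with h
  · have := sum_abs_eigenvalues_sub_le (hρ.1.smul hε) (hσ.1.smul hε) h
    simp only [trace_smul, hρ.2, hσ.2, smul_eq_mul, mul_one, Complex.ofReal_re] at this
    linarith
  · exact h0

lemma inv_sqrt_two_mul_self : (Real.sqrt 2 : ℂ)⁻¹ * (Real.sqrt 2 : ℂ)⁻¹ = 1 / 2 := by
  rw [← mul_inv, ← Complex.ofReal_mul, Real.mul_self_sqrt zero_le_two]
  norm_num

lemma isState_proj {n : Type*} [Fintype n] [DecidableEq n] {v : n → ℂ} (hv : v ⬝ᵥ star v = 1) :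
    IsState (proj v) :=
  ⟨posSemidef_proj v, (trace_proj v).trans hv⟩

lemma isState_proj_ket3 (a : Fin 3) : IsState (proj (ket3 a)) :=
  isState_proj (by simp [ket3])

lemma isState_proj_q01p : IsState (proj q01p) := by
  refine isState_proj ?_
  simp [q01p, ket3, dotProduct, Fin.sum_univ_three, inv_sqrt_two_mul_self]
  norm_num

lemma isState_proj_q01m : IsState (proj q01m) := by
  refine isState_proj ?_
  simp [q01m, ket3, dotProduct, Fin.sum_univ_three, inv_sqrt_two_mul_self]
  norm_num

lemma isState_proj_q12p : IsState (proj q12p) := by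
  refine isState_proj ?_
  simp [q12p, ket3, dotProduct, Fin.sum_univ_three, inv_sqrt_two_mul_self]
  norm_num

lemma isState_proj_q12m : IsState (proj q12m) := by
  refine isState_proj ?_
  simp [q12m, ket3, dotProduct, Fin.sum_univ_three, inv_sqrt_two_mul_self]
  norm_num

lemma isState_proj_PsiPlus3 : IsState (proj PsiPlus3) := by
  refine isState_proj ?_
  simp [PsiPlus3, vecKron, ket3, dotProduct, Fintype.sum_prod_type, Fin.sum_univ_three,
    inv_sqrt_two_mul_self]
  norm_num

/-- the uniform mixture `ρ₀` of the eight locally indistinguishable product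
states `ψ₂, …, ψ₉` on two qutrits is separable, and `(1−ε)ρ₀ + ε|Ψ₊⟩⟨Ψ₊|` is entangled
for `0 < ε < 1`; hence there are entangled states arbitrarily close to `ρ₀`. -/
theorem stmt_7 (ρ0 : Matrix (Fin 3 × Fin 3) (Fin 3 × Fin 3) ℂ)
    (hρ0 : ρ0 = (1/8 : ℂ) •
      (proj (vecKron (ket3 0) q01p) + proj (vecKron (ket3 0) q01m) +
       proj (vecKron (ket3 2) q12p) + proj (vecKron (ket3 2) q12m) +
       proj (vecKron q12p (ket3 0)) + proj (vecKron q12m (ket3 0)) +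
       proj (vecKron q01p (ket3 2)) + proj (vecKron q01m (ket3 2)))) :
    SeparableState ρ0 ∧
    (∀ ε : ℝ, 0 < ε → ε < 1 →
      EntangledState ((1 - (ε : ℂ)) • ρ0 + (ε : ℂ) • proj PsiPlus3)) ∧
    (∀ ε : ℝ, 0 < ε → ∃ σ, EntangledState σ ∧ traceDist ρ0 σ ≤ ε) := by
  have hsep : SeparableState ρ0 := by
    refine ⟨8, fun _ => 1 / 8,
      ![proj (ket3 0), proj (ket3 0), proj (ket3 2), proj (ket3 2),
        proj q12p, proj q12m, proj q01p, proj q01m],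
      ![proj q01p, proj q01m, proj q12p, proj q12m,
        proj (ket3 0), proj (ket3 0), proj (ket3 2), proj (ket3 2)],
      fun _ => by norm_num, by simp, ?_, ?_, ?_⟩
    · simp [Fin.forall_fin_succ, isState_proj_ket3, isState_proj_q01p, isState_proj_q01m,
        isState_proj_q12p, isState_proj_q12m]
    · simp [Fin.forall_fin_succ, isState_proj_ket3, isState_proj_q01p, isState_proj_q01m,
        isState_proj_q12p, isState_proj_q12m]
    · rw [hρ0, ← Finset.smul_sum]
      simp [Fin.sum_univ_eight, proj_vecKron]
  have hent (ε : ℝ) (h0 : 0 < ε) (h1 : ε < 1) :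
      EntangledState ((1 - (ε : ℂ)) • ρ0 + (ε : ℂ) • proj PsiPlus3) := by
    refine ⟨hsep.isState.convex_comb isState_proj_PsiPlus3 h0.le h1.le, fun h => ?_⟩
    have hzero := h.apply_eq_zero (i := 1) (j := 1)
      (by simp [hρ0, proj, vecMulVec_apply, vecKron, PsiPlus3, ket3, q01p, q01m, q12p, q12m]) 0 0
    simp [hρ0, proj, vecMulVec_apply, vecKron, PsiPlus3, ket3, q01p, q01m, q12p, q12m,
      h0.ne'] at hzero
  refine ⟨hsep, hent, fun ε hε => ⟨_, hent (min ε (1 / 2)) (lt_min hε one_half_pos)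
    ((min_le_right _ _).trans_lt one_half_lt_one), ?_⟩⟩
  exact (traceDist_convex_comb_le hsep.isState isState_proj_PsiPlus3
    (lt_min hε one_half_pos).le).trans (min_le_left _ _)
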